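/- arXiv:2109.07530 — 2 statements merged into one kernel-verified Lean document; each statement's English description precedes it below -/
import Mathlib

section
/- Let N > 1, κ ∈ {−1, 0, 1}, K = κ(N−1), and D > 0, with D < π in the case κ = 1. For a ∈ (0,D) let m_a = Vol_{K,N}(D)·h^a_{K,N,D}·𝓛¹ restricted to [0,D]. Then for every ε > 0 there exists v̄ > 0, depending only on N, K, D, ε, such that for every a ∈ (0,D) with v_{K,N,D}(a) < v̄, the outer Minkowski content of E = [0,a] satisfies |m_a⁺(E) − N^{1/N} ω_N^{1/N} m_a(E)^{(N−1)/N}| ≤ ε·N^{1/N} ω_N^{1/N} m_a(E)^{(N−1)/N}. In particular, the constant N^{1/N} ω_N^{1/N} in the local isoperimetric inequality for MCP(K,N) spaces is sharp, being asymptotically attained by these one-dimensional spaces. -/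
open MeasureTheory Filter Set

/-- The function `s_κ`. -/
noncomputable def sK (κ θ : ℝ) : ℝ :=
  if 0 < κ then Real.sin (Real.sqrt κ * θ) / Real.sqrt κ
  else if κ = 0 then θ
  else Real.sinh (Real.sqrt (-κ) * θ) / Real.sqrt (-κ)

/-- `k_D = ∫₀^D s_κ(t)^(N-1) dt`. -/
noncomputable def kD (κ N D : ℝ) : ℝ := ∫ t in (0:ℝ)..D, sK κ t ^ (N - 1)

/-- The function `f_{K,N,D}` (with `K = κ(N-1)`). -/
noncomputable def fKND (κ N D x : ℝ) : ℝ :=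
  ((∫ y in (0:ℝ)..x, (sK κ (D - y) / sK κ (D - x)) ^ (N - 1)) +
    ∫ y in x..D, (sK κ y / sK κ x) ^ (N - 1))⁻¹

/-- The model density `h^a_{K,N,D}` (with `K = κ(N-1)`). -/
noncomputable def hKND (κ N D a x : ℝ) : ℝ :=
  if x ≤ a then fKND κ N D a * (sK κ (D - x) / sK κ (D - a)) ^ (N - 1)
  else fKND κ N D a * (sK κ x / sK κ a) ^ (N - 1)

/-- The volume map `v_{K,N,D}(a) = ∫₀^a h^a_{K,N,D}`. -/
noncomputable def vKND (κ N D a : ℝ) : ℝ := ∫ x in (0:ℝ)..a, hKND κ N D a x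

/-- `ω_N = π^(N/2)/Γ(N/2+1)`. -/
noncomputable def omegaN (N : ℝ) : ℝ := Real.pi ^ (N / 2) / Real.Gamma (N / 2 + 1)

/-- `Vol_{K,N}(r) = N ω_N ∫₀^r s_κ(t)^(N-1) dt` (with `K = κ(N-1)`). -/
noncomputable def VolKN (κ N r : ℝ) : ℝ := N * omegaN N * ∫ t in (0:ℝ)..r, sK κ t ^ (N - 1)

/-- The coefficient `σ^{(s)}_{K,N-1}(θ)`, valued in `[0,∞]`. -/
noncomputable def sigmaE (K N s θ : ℝ) : ENNReal :=
  if (N - 1) * Real.pi ^ 2 ≤ K * θ ^ 2 then ⊤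
  else ENNReal.ofReal (sK (K / (N - 1)) (s * θ) / sK (K / (N - 1)) θ)

/-- A nonnegative continuous function `h` on the interval `I` is an `MCP(K,N)` density. -/
def IsMCPDensity (K N : ℝ) (I : Set ℝ) (h : ℝ → ℝ) : Prop :=
  ContinuousOn h I ∧ (∀ x ∈ I, 0 ≤ h x) ∧
    ∀ x₀ ∈ I, ∀ x₁ ∈ I, ∀ t ∈ Set.Icc (0:ℝ) 1,
      sigmaE K N (1 - t) |x₁ - x₀| ^ (N - 1) * ENNReal.ofReal (h x₀) ≤
        ENNReal.ofReal (h (t * x₁ + (1 - t) * x₀))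

/-- The measure `h·𝓛¹` restricted to `[0,D]`. -/
noncomputable def mcMeasure (D : ℝ) (h : ℝ → ℝ) : Measure ℝ :=
  (volume.restrict (Set.Icc 0 D)).withDensity fun x => ENNReal.ofReal (h x)

/-- The outer Minkowski content `μ⁺(E) = liminf_{ρ→0⁺} (μ(E^ρ) - μ(E))/ρ`. -/
noncomputable def minkContent (μ : Measure ℝ) (E : Set ℝ) : ℝ :=
  Filter.liminf (fun ρ : ℝ => ((μ (Metric.thickening ρ E)).toReal - (μ E).toReal) / ρ)
    (nhdsWithin 0 (Set.Ioi 0))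

open Topology

lemma sK_props (κ D : ℝ) (hκ : κ = -1 ∨ κ = 0 ∨ κ = 1) (hDpi : κ = 1 → D < Real.pi) :
    Continuous (sK κ) ∧ HasDerivAt (sK κ) 1 0 ∧ sK κ 0 = 0 ∧
      ∀ x, 0 < x → x ≤ D → 0 < sK κ x := by
  rcases hκ with rfl | rfl | rfl
  · have h : sK (-1) = Real.sinh := by
      funext x; simp [sK]
    rw [h]
    refine ⟨Real.continuous_sinh, ?_, Real.sinh_zero, fun x hx _ => Real.sinh_pos_iff.2 hx⟩
    simpa using Real.hasDerivAt_sinh 0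
  · have h : sK 0 = id := by
      funext x; simp [sK]
    rw [h]
    exact ⟨continuous_id, hasDerivAt_id 0, rfl, fun x hx _ => hx⟩
  · have h : sK 1 = Real.sin := by
      funext x; simp [sK]
    rw [h]
    refine ⟨Real.continuous_sin, ?_, Real.sin_zero, fun x hx hxD =>
      Real.sin_pos_of_pos_of_lt_pi hx (lt_of_le_of_lt hxD (hDpi rfl))⟩
    simpa using Real.hasDerivAt_sin 0

lemma sK_nonneg' {κ D : ℝ} (h0 : sK κ 0 = 0) (hpos : ∀ x, 0 < x → x ≤ D → 0 < sK κ x)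
    {x : ℝ} (hx : 0 ≤ x) (hxD : x ≤ D) : 0 ≤ sK κ x := by
  rcases hx.eq_or_lt with rfl | h
  · exact h0.ge
  · exact (hpos x h hxD).le

/-- measure of a set squeezed between `Ico 0 b` and `Icc 0 b` -/
lemma mc_toReal (D b : ℝ) (g : ℝ → ℝ) (hg : Continuous g) (hgn : ∀ x ∈ Icc 0 D, 0 ≤ g x)
    (hb : 0 ≤ b) (hbD : b ≤ D) (S : Set ℝ) (hS : MeasurableSet S)
    (h1 : S ∩ Icc 0 D = Icc 0 b ∨ S ∩ Icc 0 D = Ico 0 b) :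
    (mcMeasure D g S).toReal = ∫ x in (0:ℝ)..b, g x := by
  unfold mcMeasure
  rw [withDensity_apply _ hS, Measure.restrict_restrict hS]
  have h2 : (volume.restrict (S ∩ Icc 0 D)) = volume.restrict (Ioc (0:ℝ) b) := by
    rcases h1 with h | h <;> rw [h]
    · exact Measure.restrict_congr_set Ioc_ae_eq_Icc.symm
    · exact Measure.restrict_congr_set Ico_ae_eq_Ioc
  rw [h2, intervalIntegral.integral_of_le hb]
  rw [integral_eq_lintegral_of_nonneg_ae]
  · filter_upwards [ae_restrict_mem measurableSet_Ioc] with x hx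
    exact hgn x ⟨hx.1.le, hx.2.trans hbD⟩
  · exact hg.aestronglyMeasurable

lemma mink_eq (D a : ℝ) (g : ℝ → ℝ) (hg : Continuous g) (hgn : ∀ x ∈ Icc 0 D, 0 ≤ g x)
    (ha : 0 < a) (haD : a < D) :
    minkContent (mcMeasure D g) (Icc 0 a) = g a := by
  unfold minkContent
  apply Tendsto.liminf_eq
  have hd : HasDerivAt (fun u => ∫ x in (0:ℝ)..u, g x) (g a) a :=
    intervalIntegral.integral_hasDerivAt_right (hg.intervalIntegrable _ _)
      (hg.stronglyMeasurableAtFilter _ _) hg.continuousAt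
  have ht := hd.tendsto_slope_zero_right
  refine ht.congr' ?_
  have hlt : ∀ᶠ ρ in 𝓝[>] (0:ℝ), ρ < D - a :=
    nhdsWithin_le_nhds (eventually_lt_nhds (by linarith))
  filter_upwards [hlt, self_mem_nhdsWithin] with ρ hρ hρ0
  have hρ0 : 0 < ρ := hρ0
  rw [mc_toReal D a g hg hgn ha.le haD.le _ measurableSet_Icc,
    mc_toReal D (a + ρ) g hg hgn (by linarith) (by linarith) _
      Metric.isOpen_thickening.measurableSet]
  · rw [smul_eq_mul]; field_simp
  · right
    ext x
    simp only [mem_inter_iff, mem_Icc, mem_Ico, Metric.mem_thickening_iff, Real.dist_eq]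
    constructor
    · rintro ⟨⟨z, hz, hxz⟩, hx⟩
      exact ⟨hx.1, by linarith [(abs_lt.1 hxz).2, hz.2]⟩
    · rintro ⟨hx0, hx1⟩
      refine ⟨?_, hx0, by linarith⟩
      rcases le_total x a with h | h
      · exact ⟨x, ⟨hx0, h⟩, by simpa using hρ0⟩
      · exact ⟨a, ⟨ha.le, le_rfl⟩, by rw [abs_lt]; constructor <;> linarith⟩
  · left
    ext x
    simp only [mem_inter_iff, mem_Icc]
    constructor
    · exact fun h => h.1
    · exact fun h => ⟨h, h.1, by linarith [h.2]⟩

/-- `A(a)` -/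
noncomputable def AA (κ N D a : ℝ) : ℝ :=
  (∫ y in (0:ℝ)..a, sK κ (D - y) ^ (N - 1)) / sK κ (D - a) ^ (N - 1)

/-- `B(a)` -/
noncomputable def BB (κ N D a : ℝ) : ℝ :=
  (∫ y in a..D, sK κ y ^ (N - 1)) / sK κ a ^ (N - 1)

section
variable {κ N D : ℝ}

lemma int_A (h0 : sK κ 0 = 0) (hpos : ∀ x, 0 < x → x ≤ D → 0 < sK κ x)
    {a : ℝ} (ha : 0 < a) (haD : a < D) :
    (∫ y in (0:ℝ)..a, (sK κ (D - y) / sK κ (D - a)) ^ (N - 1)) = AA κ N D a := by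
  unfold AA
  rw [← intervalIntegral.integral_div]
  apply intervalIntegral.integral_congr
  intro y hy
  rw [uIcc_of_le ha.le] at hy
  exact Real.div_rpow (sK_nonneg' h0 hpos (by linarith [hy.2]) (by linarith [hy.1]))
    (sK_nonneg' h0 hpos (by linarith) (by linarith)) _

lemma int_B (h0 : sK κ 0 = 0) (hpos : ∀ x, 0 < x → x ≤ D → 0 < sK κ x)
    {a : ℝ} (ha : 0 < a) (haD : a < D) :
    (∫ y in a..D, (sK κ y / sK κ a) ^ (N - 1)) = BB κ N D a := by
  unfold BB
  rw [← intervalIntegral.integral_div]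
  apply intervalIntegral.integral_congr
  intro y hy
  rw [uIcc_of_le haD.le] at hy
  exact Real.div_rpow (sK_nonneg' h0 hpos (by linarith [hy.1]) (by linarith [hy.2]))
    (sK_nonneg' h0 hpos (by linarith) (by linarith)) _

lemma f_eq (h0 : sK κ 0 = 0) (hpos : ∀ x, 0 < x → x ≤ D → 0 < sK κ x)
    {a : ℝ} (ha : 0 < a) (haD : a < D) :
    fKND κ N D a = (AA κ N D a + BB κ N D a)⁻¹ := by
  unfold fKND
  rw [int_A h0 hpos ha haD, int_B h0 hpos ha haD]

lemma v_eq (h0 : sK κ 0 = 0) (hpos : ∀ x, 0 < x → x ≤ D → 0 < sK κ x)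
    {a : ℝ} (ha : 0 < a) (haD : a < D) :
    (∫ x in (0:ℝ)..a, hKND κ N D a x) = fKND κ N D a * AA κ N D a := by
  rw [← int_A h0 hpos ha haD, ← intervalIntegral.integral_const_mul]
  apply intervalIntegral.integral_congr
  intro y hy
  rw [uIcc_of_le ha.le] at hy
  simp [hKND, hy.2]

lemma cont1 (hN : 1 < N) (hc : Continuous (sK κ)) : Continuous fun y => sK κ y ^ (N - 1) :=
  hc.rpow_const (fun _ => Or.inr (by linarith))

lemma cont2 (hN : 1 < N) (hc : Continuous (sK κ)) :
    Continuous fun y => sK κ (D - y) ^ (N - 1) :=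
  (cont1 hN hc).comp (continuous_const.sub continuous_id)

lemma A_pos (hN : 1 < N) (hc : Continuous (sK κ)) (hpos : ∀ x, 0 < x → x ≤ D → 0 < sK κ x)
    {a : ℝ} (ha : 0 < a) (haD : a < D) : 0 < ∫ y in (0:ℝ)..a, sK κ (D - y) ^ (N - 1) := by
  apply intervalIntegral.intervalIntegral_pos_of_pos_on ((cont2 hN hc).intervalIntegrable _ _) _ ha
  intro x hx
  exact Real.rpow_pos_of_pos (hpos _ (by linarith [hx.2]) (by linarith [hx.1])) _

lemma B_pos (hN : 1 < N) (hc : Continuous (sK κ)) (hpos : ∀ x, 0 < x → x ≤ D → 0 < sK κ x)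
    {a : ℝ} (ha : 0 ≤ a) (haD : a < D) : 0 < ∫ y in a..D, sK κ y ^ (N - 1) := by
  apply intervalIntegral.intervalIntegral_pos_of_pos_on ((cont1 hN hc).intervalIntegrable _ _) _ haD
  intro x hx
  exact Real.rpow_pos_of_pos (hpos _ (by linarith [hx.1]) (by linarith [hx.2])) _

lemma AA_pos (hN : 1 < N) (hc : Continuous (sK κ)) (hpos : ∀ x, 0 < x → x ≤ D → 0 < sK κ x)
    {a : ℝ} (ha : 0 < a) (haD : a < D) : 0 < AA κ N D a :=
  div_pos (A_pos hN hc hpos ha haD)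
    (Real.rpow_pos_of_pos (hpos _ (by linarith) (by linarith)) _)

lemma BB_pos (hN : 1 < N) (hc : Continuous (sK κ)) (hpos : ∀ x, 0 < x → x ≤ D → 0 < sK κ x)
    {a : ℝ} (ha : 0 < a) (haD : a < D) : 0 < BB κ N D a :=
  div_pos (B_pos hN hc hpos ha.le haD)
    (Real.rpow_pos_of_pos (hpos _ (by linarith) (by linarith)) _)

lemma h_cont (hN : 1 < N) (hc : Continuous (sK κ)) (hpos : ∀ x, 0 < x → x ≤ D → 0 < sK κ x)
    {a : ℝ} (ha : 0 < a) (haD : a < D) : Continuous (hKND κ N D a) := by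
  have hp : 0 ≤ N - 1 := by linarith
  unfold hKND
  refine Continuous.if_le ?_ ?_ continuous_id continuous_const ?_
  · exact continuous_const.mul (((hc.comp (continuous_const.sub continuous_id)).div_const _).rpow_const
      (fun _ => Or.inr hp))
  · exact continuous_const.mul ((hc.div_const _).rpow_const (fun _ => Or.inr hp))
  · intro x hx
    have hx : x = a := hx
    subst hx
    rw [div_self (hpos _ (by linarith) (by linarith)).ne', div_self (hpos _ ha haD.le).ne']

lemma h_nonneg (hN : 1 < N) (hc : Continuous (sK κ)) (h0 : sK κ 0 = 0)
    (hpos : ∀ x, 0 < x → x ≤ D → 0 < sK κ x)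
    {a : ℝ} (ha : 0 < a) (haD : a < D) (x : ℝ) (hx : x ∈ Icc 0 D) : 0 ≤ hKND κ N D a x := by
  have hf : 0 ≤ fKND κ N D a := by
    rw [f_eq h0 hpos ha haD]
    have := AA_pos hN hc hpos ha haD
    have := BB_pos hN hc hpos ha haD
    positivity
  have h1 := sK_nonneg' h0 hpos hx.1 hx.2
  have h2 := sK_nonneg' h0 hpos (x := D - x) (by linarith [hx.2]) (by linarith [hx.1])
  have h3 := sK_nonneg' h0 hpos ha.le haD.le
  have h4 := sK_nonneg' h0 hpos (x := D - a) (by linarith) (by linarith)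
  unfold hKND
  split_ifs <;> positivity

lemma h_self (hpos : ∀ x, 0 < x → x ≤ D → 0 < sK κ x)
    {a : ℝ} (ha : 0 < a) (haD : a < D) : hKND κ N D a a = fKND κ N D a := by
  simp [hKND, div_self (hpos (D - a) (by linarith) (by linarith)).ne']

/-- The volume map is bounded below away from `0`. -/
lemma v_lower (hN : 1 < N) (hc : Continuous (sK κ)) (h0 : sK κ 0 = 0)
    (hpos : ∀ x, 0 < x → x ≤ D → 0 < sK κ x) {δ : ℝ} (hδ : 0 < δ) (hδD : δ < D) :
    ∃ vbar > 0, ∀ a, δ ≤ a → a < D → vbar ≤ fKND κ N D a * AA κ N D a := by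
  have hD : 0 < D := hδ.trans hδD
  have hp : 0 < N - 1 := by linarith
  obtain ⟨xm, hxm, hm⟩ := isCompact_Icc.exists_isMinOn (nonempty_Icc.2 hδD.le)
    (hc.continuousOn (s := Icc δ D))
  obtain ⟨xM, hxM, hM⟩ := isCompact_Icc.exists_isMaxOn (nonempty_Icc.2 hD.le)
    (hc.continuousOn (s := Icc 0 D))
  have hmp : 0 < sK κ xm := hpos _ (hδ.trans_le hxm.1) hxm.2
  have hMp : 0 < sK κ xM := (hpos D hD le_rfl).trans_le (hM ⟨hD.le, le_rfl⟩)
  have hPδ := A_pos hN hc hpos hδ hδD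
  have hk := B_pos hN hc hpos le_rfl hD
  set A0 := (∫ y in (0:ℝ)..δ, sK κ (D - y) ^ (N - 1)) / sK κ xM ^ (N - 1) with hA0
  set B0 := (∫ y in (0:ℝ)..D, sK κ y ^ (N - 1)) / sK κ xm ^ (N - 1) with hB0
  have hA0p : 0 < A0 := by positivity
  have hB0p : 0 < B0 := by positivity
  refine ⟨A0 / (A0 + B0), by positivity, fun a ha haD => ?_⟩
  have ha0 : 0 < a := hδ.trans_le ha
  have hA := AA_pos hN hc hpos ha0 haD
  have hB := BB_pos hN hc hpos ha0 haD
  have hsDa : 0 < sK κ (D - a) := hpos _ (by linarith) (by linarith)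
  have h1 : A0 ≤ AA κ N D a := by
    unfold AA
    apply div_le_div₀ (A_pos hN hc hpos ha0 haD).le
    · apply intervalIntegral.integral_mono_interval le_rfl hδ.le ha
      · filter_upwards [ae_restrict_mem measurableSet_Ioc] with x hx
        exact Real.rpow_nonneg (sK_nonneg' h0 hpos (by linarith [hx.2]) (by linarith [hx.1])) _
      · exact (cont2 hN hc).intervalIntegrable _ _
    · positivity
    · exact Real.rpow_le_rpow hsDa.le (hM ⟨by linarith, by linarith⟩) hp.le
  have h2 : BB κ N D a ≤ B0 := by
    unfold BB
    apply div_le_div₀ hk.le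
    · apply intervalIntegral.integral_mono_interval ha0.le haD.le le_rfl
      · filter_upwards [ae_restrict_mem measurableSet_Ioc] with x hx
        exact Real.rpow_nonneg (sK_nonneg' h0 hpos (by linarith [hx.1]) (by linarith [hx.2])) _
      · exact (cont1 hN hc).intervalIntegrable _ _
    · positivity
    · exact Real.rpow_le_rpow hmp.le (hm ⟨ha, haD.le⟩) hp.le
  rw [f_eq h0 hpos ha0 haD, inv_mul_eq_div, div_le_div_iff₀ (by positivity) (by positivity)]
  nlinarith [mul_le_mul h1 h2 hB.le hA.le]

lemma tendsto_A (hN : 1 < N) (hD : 0 < D) (hc : Continuous (sK κ))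
    (hpos : ∀ x, 0 < x → x ≤ D → 0 < sK κ x) :
    Tendsto (fun a => AA κ N D a / a) (𝓝[>] 0) (𝓝 1) := by
  have hg := cont2 (D := D) hN hc
  have hder : HasDerivAt (fun u => ∫ x in (0:ℝ)..u, sK κ (D - x) ^ (N - 1))
      (sK κ (D - 0) ^ (N - 1)) 0 :=
    intervalIntegral.integral_hasDerivAt_right (hg.intervalIntegrable _ _)
      (hg.stronglyMeasurableAtFilter _ _) hg.continuousAt
  have ht := hder.tendsto_slope_zero_right
  have h2 : Tendsto (fun a => sK κ (D - a) ^ (N - 1)) (𝓝[>] 0) (𝓝 (sK κ (D - 0) ^ (N - 1))) :=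
    (hg.tendsto 0).mono_left nhdsWithin_le_nhds
  have hne : sK κ (D - 0) ^ (N - 1) ≠ 0 :=
    (Real.rpow_pos_of_pos (hpos _ (by linarith) (by linarith)) _).ne'
  have h3 := ht.div h2 hne
  rw [div_self hne] at h3
  refine h3.congr fun a => ?_
  simp only [Pi.div_apply, zero_add, intervalIntegral.integral_same, sub_zero, smul_eq_mul, AA]
  ring

lemma tendsto_B (hN : 1 < N) (hD : 0 < D) (hc : Continuous (sK κ))
    (hd : HasDerivAt (sK κ) 1 0) (h0 : sK κ 0 = 0)
    (hpos : ∀ x, 0 < x → x ≤ D → 0 < sK κ x) :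
    Tendsto (fun a => a ^ (N - 1) * BB κ N D a) (𝓝[>] 0)
      (𝓝 (∫ y in (0:ℝ)..D, sK κ y ^ (N - 1))) := by
  have hg := cont1 hN hc
  have h1 : Tendsto (fun a => ∫ y in a..D, sK κ y ^ (N - 1)) (𝓝[>] 0)
      (𝓝 (∫ y in (0:ℝ)..D, sK κ y ^ (N - 1))) := by
    have : Continuous fun a => ∫ y in a..D, sK κ y ^ (N - 1) := by
      have h := (intervalIntegral.continuous_primitive
        (fun a b => hg.intervalIntegrable (μ := volume) a b) D).neg
      refine h.congr fun a => ?_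
      exact (intervalIntegral.integral_symm D a).symm
    exact (this.tendsto 0).mono_left nhdsWithin_le_nhds
  have h2 := hd.tendsto_slope_zero_right
  have h3 : Tendsto (fun a => (sK κ a / a) ^ (N - 1)) (𝓝[>] 0) (𝓝 1) := by
    have := h2.rpow_const (p := N - 1) (Or.inl one_ne_zero)
    rw [Real.one_rpow] at this
    refine this.congr fun a => ?_
    rw [zero_add, h0, sub_zero, smul_eq_mul, inv_mul_eq_div]
  have h4 := h1.div h3 one_ne_zero
  rw [div_one] at h4
  refine h4.congr' ?_
  have hlt : ∀ᶠ a in 𝓝[>] (0:ℝ), a < D := nhdsWithin_le_nhds (eventually_lt_nhds hD)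
  filter_upwards [hlt, self_mem_nhdsWithin] with a haD ha
  have ha : 0 < a := ha
  have hs := hpos a ha haD.le
  simp only [Pi.div_apply, BB]
  rw [Real.div_rpow hs.le ha.le]
  have := Real.rpow_pos_of_pos hs (N - 1)
  have := Real.rpow_pos_of_pos ha (N - 1)
  field_simp

lemma tendsto_ratio (hN : 1 < N) (hD : 0 < D) (hc : Continuous (sK κ))
    (hd : HasDerivAt (sK κ) 1 0) (h0 : sK κ 0 = 0)
    (hpos : ∀ x, 0 < x → x ≤ D → 0 < sK κ x) :
    Tendsto (fun a => ((∫ y in (0:ℝ)..D, sK κ y ^ (N - 1)) /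
      (AA κ N D a ^ (N - 1) * (AA κ N D a + BB κ N D a))) ^ (1 / N)) (𝓝[>] 0) (𝓝 1) := by
  set k := ∫ y in (0:ℝ)..D, sK κ y ^ (N - 1) with hkdef
  have hk : 0 < k := B_pos hN hc hpos le_rfl hD
  have hA := tendsto_A hN hD hc hpos
  have hB := tendsto_B hN hD hc hd h0 hpos
  rw [← hkdef] at hB
  have hA1 : Tendsto (fun a => (AA κ N D a / a) ^ (N - 1)) (𝓝[>] 0) (𝓝 1) := by
    have := hA.rpow_const (p := N - 1) (Or.inl one_ne_zero)
    rwa [Real.one_rpow] at this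
  have hid : Tendsto (fun a : ℝ => a ^ (N - 1) * a) (𝓝[>] 0) (𝓝 0) := by
    have : Continuous fun a : ℝ => a ^ (N - 1) * a :=
      (continuous_id.rpow_const (fun _ => Or.inr (by linarith))).mul continuous_id
    have := (this.tendsto 0).mono_left (nhdsWithin_le_nhds (s := Ioi 0))
    simpa using this
  have hden := hA1.mul ((hid.mul hA).add hB)
  have hq := ((tendsto_const_nhds (x := k)).div hden (by simpa using hk.ne')).rpow_const
    (p := 1 / N) (Or.inl (by simp [hk.ne']))
  have hone : (k / (1 * (0 * 1 + k))) ^ (1 / N) = 1 := by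
    rw [zero_mul, zero_add, one_mul, div_self hk.ne', Real.one_rpow]
  rw [hone] at hq
  refine hq.congr' ?_
  have hlt : ∀ᶠ a in 𝓝[>] (0:ℝ), a < D := nhdsWithin_le_nhds (eventually_lt_nhds hD)
  filter_upwards [hlt, self_mem_nhdsWithin] with a haD ha
  have ha : 0 < a := ha
  have hAp := AA_pos hN hc hpos ha haD
  congr 1
  simp only [Pi.div_apply]
  rw [Real.div_rpow hAp.le ha.le]
  have := Real.rpow_pos_of_pos ha (N - 1)
  field_simp

end

lemma algebra_key {N W k A B : ℝ} (hN : 1 < N) (hW : 0 < W) (hk : 0 < k) (hA : 0 < A)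
    (hB : 0 < B) :
    W * k * (A + B)⁻¹ = (k / (A ^ (N - 1) * (A + B))) ^ (1 / N) *
      (W ^ (1 / N) * (W * k * ((A + B)⁻¹ * A)) ^ ((N - 1) / N)) := by
  have hN0 : N ≠ 0 := by positivity
  have hS : 0 < A + B := by positivity
  have hAp := Real.rpow_pos_of_pos hA (N - 1)
  generalize A + B = S at *
  have hAA : (A ^ (N - 1)) ^ (1 / N) = A ^ ((N - 1) / N) := by
    rw [← Real.rpow_mul hA.le]; congr 1; ring
  have key : ∀ x : ℝ, 0 < x → x ^ (1 / N) * x ^ ((N - 1) / N) = x := by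
    intro x hx
    rw [← Real.rpow_add hx]
    have : 1 / N + (N - 1) / N = 1 := by field_simp; ring
    rw [this, Real.rpow_one]
  have hX : 0 < W * k * S⁻¹ := by positivity
  have e1 : W * k * (S⁻¹ * A) = (W * k * S⁻¹) * A := by ring
  rw [e1, Real.mul_rpow hX.le hA.le]
  have e2 : (k / (A ^ (N - 1) * S)) ^ (1 / N) * W ^ (1 / N) * A ^ ((N - 1) / N)
      = (W * k * S⁻¹) ^ (1 / N) := by
    rw [← hAA, ← Real.mul_rpow (by positivity) hW.le, ← Real.mul_rpow (by positivity) hAp.le]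
    congr 1; field_simp
  calc W * k * S⁻¹ = (W * k * S⁻¹) ^ (1 / N) * (W * k * S⁻¹) ^ ((N - 1) / N) := (key _ hX).symm
    _ = _ := by rw [← e2]; ring

/-- sharpness of the constant `N^(1/N) ω_N^(1/N)`: for `E = [0,a]` with small
volume, `m_a⁺(E)` is within a factor `1 ± ε` of `N^(1/N) ω_N^(1/N) m_a(E)^((N-1)/N)`. -/
theorem stmt13 (N κ D : ℝ) (hN : 1 < N) (hκ : κ = -1 ∨ κ = 0 ∨ κ = 1)
    (hD : 0 < D) (hDpi : κ = 1 → D < Real.pi) :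
    ∀ ε > 0, ∃ vbar > 0, ∀ a ∈ Set.Ioo (0:ℝ) D,
      vKND κ N D a < vbar →
      |minkContent (mcMeasure D (fun x => VolKN κ N D * hKND κ N D a x)) (Set.Icc 0 a) -
          N ^ (1 / N) * omegaN N ^ (1 / N) *
            (mcMeasure D (fun x => VolKN κ N D * hKND κ N D a x) (Set.Icc 0 a)).toReal ^
              ((N - 1) / N)| ≤
        ε * (N ^ (1 / N) * omegaN N ^ (1 / N) *
          (mcMeasure D (fun x => VolKN κ N D * hKND κ N D a x) (Set.Icc 0 a)).toReal ^
            ((N - 1) / N)) := by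
  intro ε hε
  obtain ⟨hc, hd, h0, hpos⟩ := sK_props κ D hκ hDpi
  have hev := (tendsto_ratio hN hD hc hd h0 hpos).eventually (Metric.closedBall_mem_nhds 1 hε)
  obtain ⟨δ, hδ, hsub⟩ := mem_nhdsGT_iff_exists_Ioo_subset.1 hev
  have hδ : 0 < δ := hδ
  obtain ⟨vbar, hv, hlow⟩ := v_lower (δ := min δ (D / 2)) hN hc h0 hpos
    (lt_min hδ (by linarith)) (lt_of_le_of_lt (min_le_right _ _) (by linarith))
  refine ⟨vbar, hv, fun a ha hva => ?_⟩
  obtain ⟨ha0, haD⟩ := ha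
  have hv' : vKND κ N D a = fKND κ N D a * AA κ N D a := v_eq h0 hpos ha0 haD
  have haδ : a < δ := by
    by_contra hcon
    have := hlow a ((min_le_left _ _).trans (not_lt.1 hcon)) haD
    linarith
  have hR := hsub ⟨ha0, haδ⟩
  have hω : 0 < omegaN N := by
    unfold omegaN
    have := Real.Gamma_pos_of_pos (show 0 < N / 2 + 1 by linarith)
    positivity
  have hN0 : 0 < N := by linarith
  have hk := B_pos hN hc hpos le_rfl hD
  have hVol : 0 < VolKN κ N D := by unfold VolKN; positivity
  have hgc : Continuous fun x => VolKN κ N D * hKND κ N D a x :=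
    continuous_const.mul (h_cont hN hc hpos ha0 haD)
  have hgn : ∀ x ∈ Icc 0 D, 0 ≤ VolKN κ N D * hKND κ N D a x := fun x hx =>
    mul_nonneg hVol.le (h_nonneg hN hc h0 hpos ha0 haD x hx)
  have hS : Icc (0:ℝ) a ∩ Icc 0 D = Icc 0 a :=
    inter_eq_left.2 (Icc_subset_Icc_right haD.le)
  rw [mink_eq D a _ hgc hgn ha0 haD,
    mc_toReal D a _ hgc hgn ha0.le haD.le _ measurableSet_Icc (Or.inl hS),
    intervalIntegral.integral_const_mul, v_eq h0 hpos ha0 haD, h_self hpos ha0 haD,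
    f_eq h0 hpos ha0 haD, ← Real.mul_rpow hN0.le hω.le]
  have hAp := AA_pos hN hc hpos ha0 haD
  have hBp := BB_pos hN hc hpos ha0 haD
  have hW : 0 < N * omegaN N := by positivity
  have key := algebra_key hN hW hk hAp hBp
  have hR' : |((∫ y in (0:ℝ)..D, sK κ y ^ (N - 1)) /
      (AA κ N D a ^ (N - 1) * (AA κ N D a + BB κ N D a))) ^ (1 / N) - 1| ≤ ε := by
    simpa [Metric.mem_closedBall, Real.dist_eq] using hR
  unfold VolKN
  set R := ((∫ y in (0:ℝ)..D, sK κ y ^ (N - 1)) /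
      (AA κ N D a ^ (N - 1) * (AA κ N D a + BB κ N D a))) ^ (1 / N)
  set T := (N * omegaN N) ^ (1 / N) * (N * omegaN N * (∫ y in (0:ℝ)..D, sK κ y ^ (N - 1)) *
    ((AA κ N D a + BB κ N D a)⁻¹ * AA κ N D a)) ^ ((N - 1) / N) with hT
  have hTp : 0 ≤ T := by positivity
  rw [key, show R * T - T = (R - 1) * T by ring, abs_mul, abs_of_nonneg hTp]
  exact mul_le_mul_of_nonneg_right hR' hTp
end

section
/- Let N > 1, κ ∈ {−1, 0, 1}, K = κ(N−1), and D > 0, with D ≤ π in the case κ = 1. Then for every a ∈ (0, D), the function h^a_{K,N,D} is an MCP(K,N) density on [0,D]; that is, for all x₀, x₁ ∈ [0,D] and t ∈ [0,1]: h^a_{K,N,D}(t x₁ + (1−t) x₀) ≥ σ^{(1−t)}_{K,N−1}(|x₁ − x₀|)^{N−1} h^a_{K,N,D}(x₀). -/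
open MeasureTheory Filter Set

theorem sK_neg_one (x : ℝ) : sK (-1) x = Real.sinh x := by
  unfold sK; norm_num

theorem sK_zero' (x : ℝ) : sK 0 x = x := by
  unfold sK; norm_num

theorem sK_one (x : ℝ) : sK 1 x = Real.sin x := by
  unfold sK; norm_num

theorem sK_three {κ : ℝ} (hκ : κ = -1 ∨ κ = 0 ∨ κ = 1) (p q r : ℝ) :
    sK κ p * sK κ (q - r) + sK κ q * sK κ (r - p) + sK κ r * sK κ (p - q) = 0 := by
  rcases hκ with rfl | rfl | rfl
  · simp only [sK_neg_one, Real.sinh_sub]; ring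
  · simp only [sK_zero']; ring
  · simp only [sK_one, Real.sin_sub]; ring

theorem sK_odd {κ : ℝ} (hκ : κ = -1 ∨ κ = 0 ∨ κ = 1) (p : ℝ) : sK κ (-p) = - sK κ p := by
  rcases hκ with rfl | rfl | rfl
  · simp only [sK_neg_one, Real.sinh_neg]
  · simp only [sK_zero']
  · simp only [sK_one, Real.sin_neg]

theorem sK_pos {κ : ℝ} (hκ : κ = -1 ∨ κ = 0 ∨ κ = 1) {p : ℝ} (hp : 0 < p)
    (h : κ = 1 → p < Real.pi) : 0 < sK κ p := by
  rcases hκ with rfl | rfl | rfl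
  · simpa only [sK_neg_one, Real.sinh_pos_iff]
  · simpa only [sK_zero']
  · simpa only [sK_one] using Real.sin_pos_of_pos_of_lt_pi hp (h rfl)

theorem sK_nonneg {κ : ℝ} (hκ : κ = -1 ∨ κ = 0 ∨ κ = 1) {p : ℝ} (hp : 0 ≤ p)
    (h : κ = 1 → p ≤ Real.pi) : 0 ≤ sK κ p := by
  rcases hκ with rfl | rfl | rfl
  · simpa only [sK_neg_one, Real.sinh_nonneg_iff]
  · simpa only [sK_zero']
  · simpa only [sK_one] using Real.sin_nonneg_of_nonneg_of_le_pi hp (h rfl)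

/-- The function `s_κ` itself satisfies the concavity inequality. -/
theorem sK_conc {κ D : ℝ} (hκ : κ = -1 ∨ κ = 0 ∨ κ = 1) (hDpi : κ = 1 → D ≤ Real.pi)
    {x₀ x₁ t : ℝ} (h0 : x₀ ∈ Set.Icc 0 D) (h1 : x₁ ∈ Set.Icc 0 D) (ht : t ∈ Set.Icc (0:ℝ) 1) :
    sK κ ((1 - t) * |x₁ - x₀|) * sK κ x₀ ≤ sK κ |x₁ - x₀| * sK κ (t * x₁ + (1 - t) * x₀) := by
  obtain ⟨h0, h0'⟩ := h0
  obtain ⟨h1, h1'⟩ := h1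
  obtain ⟨ht, ht'⟩ := ht
  have hab : |x₁ - x₀| ≤ D := abs_le.2 ⟨by linarith, by linarith⟩
  have hn : 0 ≤ sK κ (t * |x₁ - x₀|) * sK κ x₁ := by
    refine mul_nonneg (sK_nonneg hκ (by positivity) fun h => ?_)
      (sK_nonneg hκ h1 fun h => h1'.trans (hDpi h))
    have := hDpi h
    nlinarith [abs_nonneg (x₁ - x₀)]
  have key := sK_three hκ (t * x₁ + (1 - t) * x₀) x₁ x₀
  rw [show x₀ - (t * x₁ + (1 - t) * x₀) = -(t * (x₁ - x₀)) by ring,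
    show (t * x₁ + (1 - t) * x₀) - x₁ = -((1 - t) * (x₁ - x₀)) by ring,
    sK_odd hκ, sK_odd hκ] at key
  rcases abs_choice (x₁ - x₀) with h | h
  · rw [h] at hn ⊢
    nlinarith
  · rw [h, mul_neg, sK_odd hκ] at hn
    rw [h, mul_neg, sK_odd hκ, sK_odd hκ]
    nlinarith

/-- The base of the model density. -/
noncomputable def gBase (κ D a x : ℝ) : ℝ :=
  max (sK κ (D - x) / sK κ (D - a)) (sK κ x / sK κ a)

theorem hKND_eq {N κ D a x : ℝ} (hκ : κ = -1 ∨ κ = 0 ∨ κ = 1) (hDpi : κ = 1 → D ≤ Real.pi)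
    (ha : a ∈ Set.Ioo 0 D) (hx : x ∈ Set.Icc 0 D) :
    hKND κ N D a x = fKND κ N D a * gBase κ D a x ^ (N - 1) := by
  obtain ⟨ha, ha'⟩ := ha
  obtain ⟨hx, hx'⟩ := hx
  have p1 : 0 < sK κ a := sK_pos hκ ha fun h => by have := hDpi h; linarith
  have p2 : 0 < sK κ (D - a) := sK_pos hκ (by linarith) fun h => by have := hDpi h; linarith
  have pD : 0 ≤ sK κ D := sK_nonneg hκ (by linarith) hDpi
  have key := sK_three hκ (D - x) a (a - x)
  have key := sK_three hκ D a x
  have o : sK κ (x - D) = - sK κ (D - x) := by rw [← sK_odd hκ, neg_sub]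
  unfold hKND gBase
  split_ifs with h
  · have p3 : 0 ≤ sK κ (a - x) := sK_nonneg hκ (by linarith) fun h => by have := hDpi h; linarith
    rw [max_eq_left]
    rw [div_le_div_iff₀ p1 p2]
    nlinarith [mul_nonneg pD p3]
  · have p3 : 0 ≤ sK κ (x - a) := sK_nonneg hκ (by linarith) fun h => by have := hDpi h; linarith
    have o2 : sK κ (a - x) = - sK κ (x - a) := by rw [← sK_odd hκ, neg_sub]
    rw [max_eq_right]
    rw [div_le_div_iff₀ p2 p1]
    rw [o2] at key
    nlinarith [mul_nonneg pD p3]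

/-- `h^a_{K,N,D}` is an `MCP(K,N)` density on `[0,D]`. -/
theorem stmt16 (N κ D : ℝ) (hN : 1 < N) (hκ : κ = -1 ∨ κ = 0 ∨ κ = 1)
    (hD : 0 < D) (hDpi : κ = 1 → D ≤ Real.pi) :
    ∀ a ∈ Set.Ioo (0:ℝ) D, ∀ x₀ ∈ Set.Icc (0:ℝ) D, ∀ x₁ ∈ Set.Icc (0:ℝ) D,
      ∀ t ∈ Set.Icc (0:ℝ) 1,
        sigmaE (κ * (N - 1)) N (1 - t) |x₁ - x₀| ^ (N - 1) *
            ENNReal.ofReal (hKND κ N D a x₀) ≤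
          ENNReal.ofReal (hKND κ N D a (t * x₁ + (1 - t) * x₀)) := by
  intro a ha x₀ h0 x₁ h1 t ht
  have hN' : 0 < N - 1 := by linarith
  have hxt : t * x₁ + (1 - t) * x₀ ∈ Set.Icc 0 D := by
    obtain ⟨h0, h0'⟩ := h0
    obtain ⟨h1, h1'⟩ := h1
    obtain ⟨ht, ht'⟩ := ht
    constructor <;> nlinarith
  have hab : |x₁ - x₀| ≤ D :=
    abs_le.2 ⟨by linarith [h0.1, h0.2, h1.1, h1.2], by linarith [h0.1, h0.2, h1.1, h1.2]⟩
  have p1 : 0 < sK κ a := sK_pos hκ ha.1 fun h => by have := hDpi h; linarith [ha.2]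
  have p2 : 0 < sK κ (D - a) := sK_pos hκ (by linarith [ha.2])
    fun h => by have := hDpi h; linarith [ha.1]
  have gnn : ∀ x ∈ Set.Icc 0 D, 0 ≤ gBase κ D a x := fun x hx =>
    le_max_of_le_right (div_nonneg (sK_nonneg hκ hx.1 fun h => hx.2.trans (hDpi h)) p1.le)
  rw [hKND_eq hκ hDpi ha h0, hKND_eq hκ hDpi ha hxt]
  rw [ENNReal.ofReal_mul' (Real.rpow_nonneg (gnn _ h0) _),
    ENNReal.ofReal_mul' (Real.rpow_nonneg (gnn _ hxt) _)]
  unfold sigmaE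
  rw [mul_div_assoc, div_self hN'.ne', mul_one]
  split_ifs with hc
  · -- the degenerate case `κ = 1`, `|x₁ - x₀| = D = π`
    have hpi := Real.pi_pos
    have hsq : Real.pi ^ 2 ≤ κ * |x₁ - x₀| ^ 2 := by
      rw [mul_right_comm, mul_comm] at hc
      exact le_of_mul_le_mul_right hc hN'
    have hk1 : κ = 1 := by
      rcases hκ with rfl | rfl | rfl
      · nlinarith [sq_nonneg |x₁ - x₀|]
      · nlinarith
      · rfl
    subst hk1
    have hle : Real.pi ≤ |x₁ - x₀| := by
      rw [one_mul] at hsq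
      exact le_of_sq_le_sq hsq (abs_nonneg _)
    have hDe : D = Real.pi := le_antisymm (hDpi rfl) (hle.trans hab)
    subst hDe
    have hz : gBase 1 Real.pi a x₀ = 0 := by
      have : x₀ = 0 ∨ x₀ = Real.pi := by
        rcases abs_choice (x₁ - x₀) with h | h
        · left; linarith [h0.1, h1.2]
        · right; linarith [h0.2, h1.1]
      unfold gBase
      rcases this with rfl | rfl <;> simp [sK_one]
    rw [hz, Real.zero_rpow hN'.ne']
    simp
  · rcases (abs_nonneg (x₁ - x₀)).eq_or_lt with hθ | hθ
    · rw [← hθ]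
      have : sK κ 0 = 0 := by
        have := sK_odd hκ 0
        rw [neg_zero] at this
        linarith
      simp [this, ENNReal.zero_rpow_of_pos hN']
    · have pθ : 0 < sK κ |x₁ - x₀| := by
        refine sK_pos hκ hθ fun h => ?_
        subst h
        by_contra hcon
        push Not at hcon
        apply hc
        rw [one_mul]
        have := Real.pi_pos
        gcongr
      have hs : 0 ≤ sK κ ((1 - t) * |x₁ - x₀|) := by
        refine sK_nonneg hκ (mul_nonneg (by linarith [ht.2]) hθ.le) fun h => ?_
        have := hDpi h
        nlinarith [ht.1]
      have e1 := sK_conc hκ hDpi h0 h1 ht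
      have e2 := sK_conc (x₀ := D - x₀) (x₁ := D - x₁) hκ hDpi
        ⟨by linarith [h0.2], by linarith [h0.1]⟩ ⟨by linarith [h1.2], by linarith [h1.1]⟩ ht
      rw [show D - x₁ - (D - x₀) = -(x₁ - x₀) by ring, abs_neg,
        show t * (D - x₁) + (1 - t) * (D - x₀) = D - (t * x₁ + (1 - t) * x₀) by ring] at e2
      have hσ := div_nonneg hs pθ.le
      have main : sK κ ((1 - t) * |x₁ - x₀|) / sK κ |x₁ - x₀| * gBase κ D a x₀ ≤
          gBase κ D a (t * x₁ + (1 - t) * x₀) := by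
        unfold gBase
        rw [mul_max_of_nonneg _ _ hσ]
        apply max_le_max
        · rw [← mul_div_assoc]
          gcongr
          rw [div_mul_eq_mul_div, div_le_iff₀ pθ]
          linarith
        · rw [← mul_div_assoc]
          gcongr
          rw [div_mul_eq_mul_div, div_le_iff₀ pθ]
          linarith
      rw [ENNReal.ofReal_rpow_of_nonneg hσ hN'.le, mul_left_comm,
        ← ENNReal.ofReal_mul (Real.rpow_nonneg hσ _), ← Real.mul_rpow hσ (gnn _ h0)]
      have := mul_nonneg hσ (gnn _ h0)
      gcongr
end
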